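/- arXiv:2010.12992 — 5 statements merged into one kernel-verified Lean document; each statement's English description precedes it below -/
import Mathlib

section
/- Suppose 0 < m < n and the departure times satisfy, for all k ≥ 1 and all j, the max-plus linear dynamics d^k_j = max(d^{k−b_j}_{j−1} + r̃_j + X_j·g_j, d^{k−b̄_{j+1}}_{j+1} + s_{j+1}). Then for every choice of initial departure times and for every j, d^k_j/k converges as k → ∞ to the asymptotic average train time-headway h(m,X) = max( (Σ_j (g_j·X_j + r̃_j))/m, max_j (g_j·X_j + r̃_j + s_j), (Σ_j s_j)/(n−m) ). -/
open Filter

/-- Induction over counters `k` and, within one counter value, along increasing values of `d k`. -/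
theorem event_induction {ι : Type*} [Finite ι] (d : ℕ → ι → ℝ) (P : ℕ → ι → Prop)
    (zero : ∀ j, P 0 j)
    (succ : ∀ k j, (∀ i, P k i) → (∀ i, d (k + 1) i < d (k + 1) j → P (k + 1) i) →
      P (k + 1) j) (k : ℕ) (j : ι) : P k j := by
  induction k generalizing j with
  | zero => exact zero j
  | succ k ih =>
    let _ : Preorder ι := Preorder.lift (d (k + 1))
    induction j using (wellFounded_lt (α := ι)).induction with
    | _ j hj => exact succ k j ih hj

theorem exists_upper_bound_of_potential {ι : Type*} [Finite ι] (d : ℕ → ι → ℝ) (h : ℝ)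
    (v : ι → ℝ)
    (hd : ∀ k : ℕ, 1 ≤ k → ∀ j, ∃ (i : ι) (c : ℕ) (w : ℝ), c ≤ 1 ∧ 0 < w ∧
      d k j = d (k - c) i + w ∧ v i + w - h * c ≤ v j) :
    ∃ C : ℝ, ∀ k j, d k j ≤ C + h * k + v j := by
  obtain ⟨C, hC⟩ := (Set.finite_range fun j => d 0 j - v j).bddAbove
  refine ⟨C, event_induction d _ (fun j => ?_) fun k j ih hlt => ?_⟩
  · have := hC (Set.mem_range_self j)
    push_cast
    linarith
  · obtain ⟨i, c, w, hc, hw, hdw, hv⟩ := hd (k + 1) (by omega) j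
    interval_cases c
    · have := hlt i (by rw [hdw, Nat.sub_zero]; linarith)
      rw [hdw, Nat.sub_zero]
      push_cast at *
      linarith
    · have := ih i
      rw [hdw, Nat.add_sub_cancel]
      push_cast at *
      linarith

theorem exists_lower_bound_of_potential {ι : Type*} [Finite ι] (d : ℕ → ι → ℝ) (h : ℝ)
    (v : ι → ℝ) (σ : ι → ι) (c : ι → ℕ) (w : ι → ℝ) (hc : ∀ j, c j ≤ 1) (hw : ∀ j, 0 < w j)
    (hd : ∀ k : ℕ, 1 ≤ k → ∀ j, d (k - c j) (σ j) + w j ≤ d k j)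
    (hv : ∀ j, v j ≤ v (σ j) + w j - h * c j) :
    ∃ C : ℝ, ∀ k j, C + h * k + v j ≤ d k j := by
  obtain ⟨C, hC⟩ := (Set.finite_range fun j => d 0 j - v j).bddBelow
  refine ⟨C, event_induction d _ (fun j => ?_) fun k j ih hlt => ?_⟩
  · have := hC (Set.mem_range_self j)
    push_cast
    linarith
  · have hdj := hd (k + 1) (by omega) j
    have hvj := hv j
    have hwj := hw j
    rcases Nat.le_one_iff_eq_zero_or_eq_one.1 (hc j) with h0 | h1
    · rw [h0, Nat.sub_zero] at hdj
      rw [h0] at hvj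
      have := hlt (σ j) (by linarith)
      push_cast at *
      linarith
    · rw [h1, Nat.add_sub_cancel] at hdj
      rw [h1] at hvj
      have := ih (σ j)
      push_cast at *
      linarith

theorem ZMod.sum_range_natCast {n : ℕ} [NeZero n] (u : ZMod n → ℝ) :
    ∑ i ∈ Finset.range n, u (i : ZMod n) = ∑ j, u j :=
  Finset.sum_bij' (fun i _ => (i : ZMod n)) (fun j _ => j.val) (by simp)
    (fun j _ => Finset.mem_range.2 j.val_lt)
    (fun i hi => ZMod.val_natCast_of_lt (Finset.mem_range.1 hi))
    (fun j _ => ZMod.natCast_zmod_val j) (by simp)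

theorem ZMod.exists_sub_eq_of_sum_eq_zero {n : ℕ} [NeZero n] (u : ZMod n → ℝ)
    (hu : ∑ j, u j = 0) : ∃ v : ZMod n → ℝ, ∀ j, v j - v (j - 1) = u j := by
  refine ⟨fun j => ∑ i ∈ Finset.range (j + 1 : ZMod n).val, u i, fun j => ?_⟩
  have hj : (j.val : ZMod n) = j := ZMod.natCast_zmod_val j
  have hval : (j + 1).val = (j.val + 1) % n := by
    rw [← ZMod.val_natCast, Nat.cast_succ, hj]
  simp only [sub_add_cancel]
  rcases Nat.lt_or_ge (j.val + 1) n with hlt | hge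
  · rw [hval, Nat.mod_eq_of_lt hlt, Finset.sum_range_succ, hj]
    ring
  · have hn : j.val + 1 = n := le_antisymm j.val_lt hge
    have hsum := Finset.sum_range_succ (fun i : ℕ => u i) j.val
    rw [hn, ZMod.sum_range_natCast, hu, hj] at hsum
    rw [hval, hn, Nat.mod_self, Finset.sum_range_zero]
    linarith

theorem ZMod.forall_of_sub_one {n : ℕ} [NeZero n] {P : ZMod n → Prop}
    (step : ∀ j, P (j - 1) → P j) {i : ZMod n} (hi : P i) (j : ZMod n) : P j := by
  have key : ∀ t : ℕ, P (i + t) := by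
    intro t
    induction t with
    | zero => simpa using hi
    | succ t ih =>
      apply step
      convert ih using 1
      push_cast
      ring
  simpa using key (j - i).val

theorem exists_between_sum_eq_zero {ι : Type*} [Fintype ι] {α β : ι → ℝ}
    (hle : ∀ j, α j ≤ β j) (hα : ∑ j, α j ≤ 0) (hβ : 0 ≤ ∑ j, β j) :
    ∃ u : ι → ℝ, (∀ j, α j ≤ u j ∧ u j ≤ β j) ∧ ∑ j, u j = 0 := by
  rcases hα.eq_or_lt with h0 | hneg
  · exact ⟨α, fun j => ⟨le_rfl, hle j⟩, h0⟩
  set A := ∑ j, α j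
  set B := ∑ j, β j
  have hpos : 0 < B - A := by linarith
  have ht0 : 0 ≤ -A / (B - A) := div_nonneg (by linarith) hpos.le
  have ht1 : -A / (B - A) ≤ 1 := (div_le_one hpos).2 (by linarith)
  refine ⟨fun j => α j + -A / (B - A) * (β j - α j), fun j => ⟨?_, ?_⟩, ?_⟩
  · nlinarith [hle j]
  · nlinarith [hle j]
  · rw [Finset.sum_add_distrib, ← Finset.mul_sum, Finset.sum_sub_distrib,
      div_mul_cancel₀ _ hpos.ne']
    exact add_neg_cancel A

theorem tendsto_div_natCast_of_bounds {f : ℕ → ℝ} {h C D : ℝ}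
    (hC : ∀ k : ℕ, C + h * k ≤ f k) (hD : ∀ k : ℕ, f k ≤ D + h * k) :
    Tendsto (fun k : ℕ => f k / (k : ℝ)) atTop (nhds h) := by
  have lim : ∀ E : ℝ, Tendsto (fun k : ℕ => E / (k : ℝ) + h) atTop (nhds h) := fun E => by
    simpa using (tendsto_const_div_atTop_nhds_zero_nat E).add_const h
  refine tendsto_of_tendsto_of_tendsto_of_le_of_le' (lim C) (lim D) ?_ ?_ <;>
  filter_upwards [eventually_gt_atTop 0] with k hk <;>
  have hk' : (0 : ℝ) < k := Nat.cast_pos.2 hk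
  · rw [le_div_iff₀ hk', add_mul, div_mul_cancel₀ _ hk'.ne']
    exact hC k
  · rw [div_le_iff₀ hk', add_mul, div_mul_cancel₀ _ hk'.ne']
    exact hD k

/-- On a linear metro line with `0 < m < n` trains, if the departure times satisfy the
max-plus linear dynamics with demand-dependent controlled travel times
`r̃_j + X_j·g_j`, then for every choice of initial departure times and every node `j`,
`d^k_j / k` converges to the asymptotic average train time-headway
`h(m,X) = max( (Σ_j (g_j X_j + r̃_j))/m, max_j (g_j X_j + r̃_j + s_j), (Σ_j s_j)/(n−m) )`. -/
theorem linear_line_demand_dependent_asymptotic_headway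
    (n : ℕ) [NeZero n]
    (b : ZMod n → ℕ) (hb : ∀ j, b j ≤ 1)
    (s r Δr g gbar x : ZMod n → ℝ)
    (hs : ∀ j, 0 < s j) (hr : ∀ j, 0 < r j) (hΔr : ∀ j, 0 ≤ Δr j)
    (hg : ∀ j, 0 < g j) (hggbar : ∀ j, g j ≤ gbar j)
    (hx : ∀ j, 0 < x j ∧ x j < 1)
    (rt X : ZMod n → ℝ)
    (hrt : ∀ j, rt j = r j + Δr j) (hX : ∀ j, X j = x j / (1 - x j))
    (m : ℕ) (hm : m = ∑ j, b j) (hm0 : 0 < m) (hmn : m < n)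
    (d : ℕ → ZMod n → ℝ)
    (hdyn : ∀ k : ℕ, 1 ≤ k → ∀ j : ZMod n,
      d k j = max (d (k - b j) (j - 1) + (rt j + X j * g j))
        (d (k - (1 - b (j + 1))) (j + 1) + s (j + 1)))
    (h : ℝ)
    (hh : h = max ((∑ j, (g j * X j + rt j)) / (m : ℝ))
      (max (⨆ j, (g j * X j + rt j + s j)) ((∑ j, s j) / ((n : ℝ) - (m : ℝ))))) :
    ∀ j : ZMod n, Tendsto (fun k : ℕ => d k j / (k : ℝ)) atTop (nhds h) := by
  set a : ZMod n → ℝ := fun j => rt j + X j * g j with ha_def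
  have ha : ∀ j, 0 < a j := fun j => by
    have : 0 < X j := hX j ▸ div_pos (hx j).1 (sub_pos.2 (hx j).2)
    have := mul_pos this (hg j)
    have := hr j
    have := hΔr j
    simp only [ha_def, hrt j]
    linarith
  have hm0' : (0 : ℝ) < m := Nat.cast_pos.2 hm0
  have hmn' : (0 : ℝ) < n - m := sub_pos.2 (Nat.cast_lt.2 hmn)
  have hbsum : ∑ j, (b j : ℝ) = m := by rw [hm, Nat.cast_sum]
  have hcast : ∀ j, ((1 - b j : ℕ) : ℝ) = 1 - b j := fun j => by
    rw [Nat.cast_sub (hb j), Nat.cast_one]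
  have hh' : h = max ((∑ j, a j) / (m : ℝ))
      (max (⨆ j, (a j + s j)) ((∑ j, s j) / ((n : ℝ) - m))) := by
    rw [hh]
    simp only [ha_def, add_comm, mul_comm]
  have hfin : BddAbove (Set.range fun j => a j + s j) := (Set.finite_range _).bddAbove
  have hA : ∑ j, a j ≤ h * m := by
    rw [← div_le_iff₀ hm0', hh']
    exact le_max_left _ _
  have hAS : ∀ j, a j + s j ≤ h := fun j => by
    rw [hh']
    exact (le_ciSup hfin j).trans ((le_max_left _ _).trans (le_max_right _ _))
  have hS : ∑ j, s j ≤ h * (n - m) := by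
    rw [← div_le_iff₀ hmn', hh']
    exact (le_max_right _ _).trans (le_max_right _ _)
  have hh0 : 0 ≤ h := by linarith [hAS 0, ha 0, hs 0]
  have sumα : ∑ j, (a j - h * b j) = ∑ j, a j - h * m := by
    rw [Finset.sum_sub_distrib, ← Finset.mul_sum, hbsum]
  have sumβ : ∑ j, (h * (1 - b j) - s j) = h * (n - m) - ∑ j, s j := by
    rw [Finset.sum_sub_distrib, ← Finset.mul_sum, Finset.sum_sub_distrib, hbsum]
    simp [ZMod.card]
  have hfwd : ∀ k : ℕ, 1 ≤ k → ∀ j, d (k - b j) (j - 1) + a j ≤ d k j := fun k hk j => by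
    rw [hdyn k hk j]
    exact le_max_left _ _
  have hbwd : ∀ k : ℕ, 1 ≤ k → ∀ j,
      d (k - (1 - b (j + 1))) (j + 1) + s (j + 1) ≤ d k j := fun k hk j => by
    rw [hdyn k hk j]
    exact le_max_right _ _
  have upper : ∀ j, ∃ D, ∀ k : ℕ, d k j ≤ D + h * k := by
    obtain ⟨u, hu, hu0⟩ := exists_between_sum_eq_zero
      (α := fun j => a j - h * b j) (β := fun j => h * (1 - b j) - s j)
      (fun j => by linarith [hAS j]) (by rw [sumα]; linarith) (by rw [sumβ]; linarith)
    obtain ⟨v, hv⟩ := ZMod.exists_sub_eq_of_sum_eq_zero u hu0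
    obtain ⟨D, hD⟩ := exists_upper_bound_of_potential d h v fun k hk j => by
      rcases max_choice (d (k - b j) (j - 1) + a j)
        (d (k - (1 - b (j + 1))) (j + 1) + s (j + 1)) with hmax | hmax
      · exact ⟨j - 1, b j, a j, hb j, ha j, (hdyn k hk j).trans hmax,
          by linarith [(hu j).1, hv j]⟩
      · refine ⟨j + 1, 1 - b (j + 1), s (j + 1), Nat.sub_le _ _, hs _,
          (hdyn k hk j).trans hmax, ?_⟩
        have := hv (j + 1)
        rw [add_sub_cancel_right] at this
        rw [hcast]
        linarith [(hu (j + 1)).2]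
    exact fun j => ⟨D + v j, fun k => by linarith [hD k j]⟩
  have lower_at : ∃ i, ∃ C, ∀ k : ℕ, C + h * k ≤ d k i := by
    rcases max_choice ((∑ j, a j) / (m : ℝ))
      (max (⨆ j, (a j + s j)) ((∑ j, s j) / ((n : ℝ) - m))) with hmax | hmax
    · have hhm : h * m = ∑ j, a j := by
        rw [hh', hmax, div_mul_cancel₀ _ hm0'.ne']
      obtain ⟨v, hv⟩ := ZMod.exists_sub_eq_of_sum_eq_zero (fun j => a j - h * b j)
        (by rw [sumα, hhm, sub_self])
      obtain ⟨C, hC⟩ := exists_lower_bound_of_potential d h v (fun j => j - 1) b a hb ha hfwd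
        fun j => by linarith [hv j]
      exact ⟨0, C + v 0, fun k => by linarith [hC k 0]⟩
    rw [hmax] at hh'
    rcases max_choice (⨆ j, (a j + s j)) ((∑ j, s j) / ((n : ℝ) - m)) with hmax | hmax
    · obtain ⟨i, hi⟩ := exists_eq_ciSup_of_finite (f := fun j => a j + s j)
      have hhi : a i + s i = h := by rw [hh', hmax, ← hi]
      obtain ⟨C, hC⟩ := exists_lower_bound_of_potential
        (fun k (t : Bool) => d k (if t then i else i - 1)) h
        (fun t => if t then a i - h * b i else 0) not
        (fun t => if t then b i else 1 - b i) (fun t => if t then a i else s i)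
        (by simp [hb]) (by simp [ha, hs])
        (fun k hk t => by
          cases t
          · simpa using hbwd k hk (i - 1)
          · simpa using hfwd k hk i)
        (fun t => by
          cases t
          · simp only [Bool.not_false, if_true, Bool.false_eq_true, if_false, hcast]
            linarith
          · simp)
      exact ⟨i, C + (a i - h * b i), fun k => by
        have := hC k true
        simp only [if_true] at this
        linarith⟩
    · have hhm : h * (n - m) = ∑ j, s j := by
        rw [hh', hmax, div_mul_cancel₀ _ hmn'.ne']
      obtain ⟨v, hv⟩ := ZMod.exists_sub_eq_of_sum_eq_zero (fun j => h * (1 - b j) - s j)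
        (by rw [sumβ, hhm, sub_self])
      obtain ⟨C, hC⟩ := exists_lower_bound_of_potential d h v (fun j => j + 1)
        (fun j => 1 - b (j + 1)) (fun j => s (j + 1)) (fun j => Nat.sub_le _ _)
        (fun j => hs _) hbwd fun j => by
          have := hv (j + 1)
          rw [add_sub_cancel_right] at this
          rw [hcast]
          linarith
      exact ⟨0, C + v 0, fun k => by linarith [hC k 0]⟩
  have lower_step : ∀ j, (∃ C, ∀ k : ℕ, C + h * k ≤ d k (j - 1)) →
      ∃ C, ∀ k : ℕ, C + h * k ≤ d k j := by
    rintro j ⟨C, hC⟩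
    refine ⟨min (d 0 j) (C - h), fun k => ?_⟩
    rcases Nat.eq_zero_or_pos k with rfl | hk
    · simp
    · have hbj : (b j : ℝ) ≤ 1 := by exact_mod_cast hb j
      have h1 := hC (k - b j)
      rw [Nat.cast_sub ((hb j).trans hk)] at h1
      have h2 := mul_le_mul_of_nonneg_left hbj hh0
      linarith [hfwd k hk j, ha j, min_le_right (d 0 j) (C - h)]
  intro j
  obtain ⟨i, hi⟩ := lower_at
  obtain ⟨C, hC⟩ := ZMod.forall_of_sub_one
    (P := fun j => ∃ C, ∀ k : ℕ, C + h * k ≤ d k j) lower_step hi j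
  obtain ⟨D, hD⟩ := upper j
  exact tendsto_div_natCast_of_bounds hC hD
end

section
/- Suppose 0 < m < n and the departure times satisfy, for all k ≥ 1 and all j, the max-plus linear dynamics d^k_j = max(d^{k−b_j}_{j−1} + r̃_j + X_j·g_j, d^{k−b̄_{j+1}}_{j+1} + s_{j+1}). Then the asymptotic average train frequency f(m,X) := lim_{k→∞} k/d^k_j exists, is independent of j and of the initial departure times, and equals min( m/(Σ_j (g_j·X_j + r̃_j)), 1/max_j (g_j·X_j + r̃_j + s_j), (n−m)/(Σ_j s_j) ). -/
open Filter

/-- A function on `ZMod n` with zero sum is the backward difference of some potential. -/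
lemma exists_potential_of_sum_eq_zero (n : ℕ) [NeZero n] (δ : ZMod n → ℝ)
    (hδ : ∑ j, δ j = 0) : ∃ v : ZMod n → ℝ, ∀ j, v j = v (j - 1) + δ j := by
  obtain ⟨p, rfl⟩ : ∃ p, n = p + 1 := Nat.exists_eq_succ_of_ne_zero (NeZero.ne n)
  have hsum : ∑ i ∈ Finset.range (p + 1), δ (i : ZMod (p + 1)) = 0 := by
    rw [← hδ, Finset.sum_range]
    refine Finset.sum_congr rfl fun i _ => congrArg δ ?_
    exact Fin.cast_val_eq_self i
  refine ⟨fun j => ∑ i ∈ Finset.range (j.val + 1), δ (i : ZMod (p + 1)), fun j => ?_⟩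
  dsimp only
  by_cases hj : j = 0
  · subst hj
    rw [zero_sub, ZMod.val_neg_one, hsum]
    simp
  · have hj' : (j - 1).val + 1 = j.val := by
      have hpos : 0 < j.val := Nat.pos_of_ne_zero fun h => hj ((ZMod.val_eq_zero j).1 h)
      have hlt := ZMod.val_lt j
      have heq : j - 1 = ((j.val - 1 : ℕ) : ZMod (p + 1)) := by
        rw [Nat.cast_sub hpos, ZMod.natCast_zmod_val, Nat.cast_one]
      rw [heq, ZMod.val_natCast, Nat.mod_eq_of_lt (by omega)]
      omega
    rw [Finset.sum_range_succ, hj', ZMod.natCast_zmod_val]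

/-- If `l ≤ u` pointwise and the sum of `l` is nonpositive while that of `u` is nonnegative,
some function between `l` and `u` has zero sum. -/
lemma exists_between_sum_eq_zero_s5 {ι : Type*} [Fintype ι] (l u : ι → ℝ) (h : ∀ i, l i ≤ u i)
    (hl : ∑ i, l i ≤ 0) (hu : 0 ≤ ∑ i, u i) :
    ∃ δ : ι → ℝ, (∀ i, l i ≤ δ i) ∧ (∀ i, δ i ≤ u i) ∧ ∑ i, δ i = 0 := by
  set L := ∑ i, l i
  set U := ∑ i, u i
  obtain ⟨θ, h0, h1, hθ⟩ : ∃ θ : ℝ, 0 ≤ θ ∧ θ ≤ 1 ∧ L + θ * (U - L) = 0 := by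
    rcases eq_or_lt_of_le (hl.trans hu) with hLU | hLU
    · exact ⟨0, le_rfl, zero_le_one, by linarith⟩
    · have hpos : 0 < U - L := sub_pos.2 hLU
      refine ⟨-L / (U - L), div_nonneg (by linarith) hpos.le, (div_le_one hpos).2 (by linarith), ?_⟩
      field_simp
      ring
  refine ⟨fun i => l i + θ * (u i - l i), fun i => ?_, fun i => ?_, ?_⟩
  · nlinarith [h i]
  · nlinarith [h i]
  · rw [Finset.sum_add_distrib, ← Finset.mul_sum, Finset.sum_sub_distrib]
    exact hθ

/-- Induction along the dynamics of the line: if `0 < m < n`, the dependencies between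
departures with the same index are acyclic. -/
lemma line_induction (n : ℕ) [NeZero n] (b : ZMod n → ℕ)
    (hm0 : 0 < ∑ j, b j) (hmn : ∑ j, b j < n) (P : ℕ → ZMod n → Prop) (h0 : ∀ j, P 0 j)
    (hstep : ∀ k j, (∀ i, P k i) → (b j = 0 → P (k + 1) (j - 1)) →
      (b (j + 1) = 1 → P (k + 1) (j + 1)) → P (k + 1) j) : ∀ k j, P k j := by
  obtain ⟨φ, hφ⟩ := exists_potential_of_sum_eq_zero n
    (fun j => ((∑ i, b i : ℕ) : ℝ) - n * (b j : ℝ)) (by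
      rw [Finset.sum_sub_distrib, ← Finset.mul_sum]
      simp [ZMod.card])
  have hm0' : (0 : ℝ) < ((∑ i, b i : ℕ) : ℝ) := by exact_mod_cast hm0
  have hmn' : ((∑ i, b i : ℕ) : ℝ) < n := by exact_mod_cast hmn
  intro k
  induction k with
  | zero => exact h0
  | succ k ih =>
    by_contra! hne
    obtain ⟨j, hj, hmin⟩ := Set.exists_min_image {j | ¬ P (k + 1) j} φ (Set.toFinite _) hne
    refine hj (hstep k j ih (fun hbj => ?_) fun hbj => ?_)
    · by_contra hP
      have h1 := hmin _ hP
      have h2 := hφ j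
      rw [hbj] at h2
      push_cast at h2 hm0'
      linarith
    · by_contra hP
      have h1 := hmin _ hP
      have h2 := hφ (j + 1)
      rw [hbj, add_sub_cancel_right] at h2
      push_cast at h2 hmn'
      linarith

/-- Departures grow at most at rate `lam` when `lam` dominates all cycle means. -/
lemma line_departure_upper_bound (n : ℕ) [NeZero n] (b : ZMod n → ℕ) (hb : ∀ j, b j ≤ 1)
    (hm0 : 0 < ∑ j, b j) (hmn : ∑ j, b j < n)
    (t s : ZMod n → ℝ) (d : ℕ → ZMod n → ℝ) (lam : ℝ)
    (hdyn : ∀ k : ℕ, 1 ≤ k → ∀ j, d k j = max (d (k - b j) (j - 1) + t j)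
      (d (k - (1 - b (j + 1))) (j + 1) + s (j + 1)))
    (h1 : ∑ j, t j ≤ (∑ j, b j : ℕ) * lam) (h2 : ∀ j, t j + s j ≤ lam)
    (h3 : ∑ j, s j ≤ (n - (∑ j, b j : ℕ)) * lam) :
    ∃ C, ∀ k j, d k j ≤ lam * k + C := by
  push_cast at h1 h3
  obtain ⟨δ, hl, hu, hδ⟩ := exists_between_sum_eq_zero_s5 (fun j => t j - b j * lam)
    (fun j => (1 - b j) * lam - s j) (fun j => by linarith [h2 j])
    (by rw [Finset.sum_sub_distrib, ← Finset.sum_mul]; linarith)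
    (by rw [Finset.sum_sub_distrib, ← Finset.sum_mul, Finset.sum_sub_distrib]
        simp only [Finset.sum_const, Finset.card_univ, ZMod.card, nsmul_eq_mul, mul_one]
        linarith)
  obtain ⟨v, hv⟩ := exists_potential_of_sum_eq_zero n δ hδ
  obtain ⟨c, hc⟩ := Finite.exists_le fun j => d 0 j - v j
  obtain ⟨V, hV⟩ := Finite.exists_le v
  have key : ∀ k j, d k j ≤ lam * k + v j + c := by
    refine line_induction n b hm0 hmn _ (fun j => ?_) fun k j hk hf hbk => ?_
    · have := hc j
      simp only [Nat.cast_zero, mul_zero]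
      linarith
    · rw [hdyn (k + 1) (by omega) j]
      refine max_le ?_ ?_
      · have hlj := hl j
        have hvj := hv j
        rcases Nat.le_one_iff_eq_zero_or_eq_one.1 (hb j) with h | h
        · have := hf h
          simp only [h, Nat.cast_zero, Nat.sub_zero] at hlj ⊢
          linarith
        · have := hk (j - 1)
          simp only [h, Nat.cast_one, Nat.add_sub_cancel] at hlj ⊢
          push_cast
          linarith
      · have huj := hu (j + 1)
        have hvj := hv (j + 1)
        rw [add_sub_cancel_right] at hvj
        rcases Nat.le_one_iff_eq_zero_or_eq_one.1 (hb (j + 1)) with h | h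
        · have := hk (j + 1)
          simp only [h, Nat.cast_zero, Nat.sub_zero, Nat.add_sub_cancel] at huj ⊢
          push_cast
          linarith
        · have := hbk h
          simp only [h, Nat.cast_one, Nat.sub_self, Nat.sub_zero] at huj ⊢
          linarith
  exact ⟨V + c, fun k j => by linarith [key k j, hV j]⟩

/-- The circuit of trains forces growth at rate at least `lam`. -/
lemma line_departure_lower_bound_of_trains (n : ℕ) [NeZero n] (b : ZMod n → ℕ) (hb : ∀ j, b j ≤ 1)
    (hm0 : 0 < ∑ j, b j) (hmn : ∑ j, b j < n)
    (t : ZMod n → ℝ) (d : ℕ → ZMod n → ℝ) (lam : ℝ)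
    (hfwd : ∀ k : ℕ, 1 ≤ k → ∀ j, d (k - b j) (j - 1) + t j ≤ d k j)
    (h1 : ∑ j, t j = (∑ j, b j : ℕ) * lam) :
    ∃ C, ∀ k j, lam * k + C ≤ d k j := by
  push_cast at h1
  obtain ⟨v, hv⟩ := exists_potential_of_sum_eq_zero n (fun j => t j - b j * lam)
    (by rw [Finset.sum_sub_distrib, ← Finset.sum_mul, h1, sub_self])
  obtain ⟨c, hc⟩ := Finite.exists_ge fun j => d 0 j - v j
  obtain ⟨V, hV⟩ := Finite.exists_ge v
  have key : ∀ k j, lam * k + v j + c ≤ d k j := by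
    refine line_induction n b hm0 hmn _ (fun j => ?_) fun k j hk hf _ => ?_
    · have := hc j
      simp only [Nat.cast_zero, mul_zero]
      linarith
    · refine le_trans ?_ (hfwd (k + 1) (by omega) j)
      have hvj := hv j
      rcases Nat.le_one_iff_eq_zero_or_eq_one.1 (hb j) with h | h
      · have := hf h
        simp only [h, Nat.cast_zero, Nat.sub_zero] at hvj ⊢
        linarith
      · have := hk (j - 1)
        simp only [h, Nat.cast_one, Nat.add_sub_cancel] at hvj ⊢
        push_cast
        linarith
  exact ⟨V + c, fun k j => by linarith [key k j, hV j]⟩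

/-- The circuit of free segments forces growth at rate at least `lam`. -/
lemma line_departure_lower_bound_of_gaps (n : ℕ) [NeZero n] (b : ZMod n → ℕ) (hb : ∀ j, b j ≤ 1)
    (hm0 : 0 < ∑ j, b j) (hmn : ∑ j, b j < n)
    (s : ZMod n → ℝ) (d : ℕ → ZMod n → ℝ) (lam : ℝ)
    (hbwd : ∀ k : ℕ, 1 ≤ k → ∀ j, d (k - (1 - b (j + 1))) (j + 1) + s (j + 1) ≤ d k j)
    (h3 : ∑ j, s j = (n - (∑ j, b j : ℕ)) * lam) :
    ∃ C, ∀ k j, lam * k + C ≤ d k j := by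
  push_cast at h3
  obtain ⟨v, hv⟩ := exists_potential_of_sum_eq_zero n (fun j => (1 - b j) * lam - s j)
    (by rw [Finset.sum_sub_distrib, ← Finset.sum_mul, Finset.sum_sub_distrib]
        simp only [Finset.sum_const, Finset.card_univ, ZMod.card, nsmul_eq_mul, mul_one]
        linarith)
  obtain ⟨c, hc⟩ := Finite.exists_ge fun j => d 0 j - v j
  obtain ⟨V, hV⟩ := Finite.exists_ge v
  have key : ∀ k j, lam * k + v j + c ≤ d k j := by
    refine line_induction n b hm0 hmn _ (fun j => ?_) fun k j hk _ hbk => ?_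
    · have := hc j
      simp only [Nat.cast_zero, mul_zero]
      linarith
    · refine le_trans ?_ (hbwd (k + 1) (by omega) j)
      have hvj := hv (j + 1)
      rw [add_sub_cancel_right] at hvj
      rcases Nat.le_one_iff_eq_zero_or_eq_one.1 (hb (j + 1)) with h | h
      · have := hk (j + 1)
        simp only [h, Nat.cast_zero, Nat.sub_zero, Nat.add_sub_cancel] at hvj ⊢
        push_cast
        linarith
      · have := hbk h
        simp only [h, Nat.cast_one, Nat.sub_self, Nat.sub_zero] at hvj ⊢
        linarith
  exact ⟨V + c, fun k j => by linarith [key k j, hV j]⟩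

/-- The two-node circuit around segment `j₀` forces growth at rate at least `t j₀ + s j₀`
at every node. -/
lemma line_departure_lower_bound_of_segment (n : ℕ) [NeZero n] (b : ZMod n → ℕ)
    (hb : ∀ j, b j ≤ 1) (t s : ZMod n → ℝ) (d : ℕ → ZMod n → ℝ)
    (hfwd : ∀ k : ℕ, 1 ≤ k → ∀ j, d (k - b j) (j - 1) + t j ≤ d k j)
    (hbwd : ∀ k : ℕ, 1 ≤ k → ∀ j, d (k - (1 - b (j + 1))) (j + 1) + s (j + 1) ≤ d k j)
    (j₀ : ZMod n) (j : ZMod n) :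
    ∃ C, ∀ k, (t j₀ + s j₀) * k + C ≤ d k j := by
  have hstep : ∀ k, 1 ≤ k → d k j₀ + (t j₀ + s j₀) ≤ d (k + 1) j₀ := by
    intro k hk
    have h1 := hfwd (k + 1) (by omega) j₀
    rcases Nat.le_one_iff_eq_zero_or_eq_one.1 (hb j₀) with h | h
    · have h2 := hbwd (k + 1) (by omega) (j₀ - 1)
      simp only [sub_add_cancel, h, Nat.sub_zero, Nat.add_sub_cancel] at h1 h2
      linarith
    · have h2 := hbwd k hk (j₀ - 1)
      simp only [sub_add_cancel, h, Nat.sub_zero, Nat.add_sub_cancel, Nat.sub_self] at h1 h2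
      linarith
  have hspread : ∀ i : ℕ, ∃ C, ∀ k, (t j₀ + s j₀) * k + C ≤ d k (j₀ + i) := by
    intro i
    induction i with
    | zero =>
      refine ⟨min (d 0 j₀) (d 1 j₀ - (t j₀ + s j₀)), fun k => ?_⟩
      rw [Nat.cast_zero, add_zero]
      rcases Nat.eq_zero_or_pos k with rfl | hk
      · simp
      · have hmin := min_le_right (d 0 j₀) (d 1 j₀ - (t j₀ + s j₀))
        induction k, hk using Nat.le_induction with
        | base => push_cast; linarith
        | succ k hk ih => have := hstep k hk; push_cast; linarith
    | succ i ih =>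
      obtain ⟨C, hC⟩ := ih
      refine ⟨min (d 0 (j₀ + (i + 1 : ℕ)))
        (C - |t j₀ + s j₀| + t (j₀ + (i + 1 : ℕ))), fun k => ?_⟩
      rcases Nat.eq_zero_or_pos k with rfl | hk
      · simp
      · have hmin := min_le_right (d 0 (j₀ + (i + 1 : ℕ)))
          (C - |t j₀ + s j₀| + t (j₀ + (i + 1 : ℕ)))
        have h1 := hfwd k hk (j₀ + (i + 1 : ℕ))
        have h2 := hC (k - b (j₀ + (i + 1 : ℕ)))
        have hj : j₀ + ((i + 1 : ℕ) : ZMod n) - 1 = j₀ + (i : ZMod n) := by push_cast; ring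
        rw [hj] at h1
        have habs := le_abs_self (t j₀ + s j₀)
        have habs0 := abs_nonneg (t j₀ + s j₀)
        rcases Nat.le_one_iff_eq_zero_or_eq_one.1 (hb (j₀ + (i + 1 : ℕ))) with h | h
        · rw [h, Nat.sub_zero] at h1 h2
          linarith
        · rw [h] at h1 h2
          rw [Nat.cast_sub hk] at h2
          push_cast at h1 h2 hmin ⊢
          linarith
  have := hspread (j - j₀).val
  rwa [ZMod.natCast_zmod_val, add_sub_cancel] at this

/-- A sequence at bounded distance from `lam * k` has frequency `1 / lam`. -/
lemma tendsto_natCast_div_of_linear_bounds (a : ℕ → ℝ) (lam C D : ℝ) (hlam : lam ≠ 0)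
    (hl : ∀ k : ℕ, lam * k + C ≤ a k) (hu : ∀ k : ℕ, a k ≤ lam * k + D) :
    Tendsto (fun k : ℕ => (k : ℝ) / a k) atTop (nhds lam⁻¹) := by
  have hlim : ∀ c : ℝ, Tendsto (fun k : ℕ => lam + c / (k : ℝ)) atTop (nhds lam) := fun c => by
    simpa using (tendsto_const_div_atTop_nhds_zero_nat c).const_add lam
  have h : Tendsto (fun k : ℕ => a k / (k : ℝ)) atTop (nhds lam) := by
    refine tendsto_of_tendsto_of_tendsto_of_le_of_le' (hlim C) (hlim D) ?_ ?_
    all_goals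
      filter_upwards [eventually_gt_atTop 0] with k hk
      have hk' : (0 : ℝ) < k := by exact_mod_cast hk
    · rw [le_div_iff₀ hk', add_mul, div_mul_cancel₀ _ hk'.ne']
      exact hl k
    · rw [div_le_iff₀ hk', add_mul, div_mul_cancel₀ _ hk'.ne']
      exact hu k
  simpa only [inv_div] using h.inv₀ hlam

/-- On a linear metro line with `0 < m < n` trains, under the max-plus linear dynamics
with demand-dependent controlled travel times, the asymptotic average train frequency
`f(m,X) = lim_k k / d^k_j` exists, is independent of `j` and of the initial departure
times, and equals
`min( m/(Σ_j (g_j X_j + r̃_j)), 1/max_j (g_j X_j + r̃_j + s_j), (n−m)/(Σ_j s_j) )`. -/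
theorem linear_line_demand_dependent_asymptotic_frequency
    (n : ℕ) [NeZero n]
    (b : ZMod n → ℕ) (hb : ∀ j, b j ≤ 1)
    (s r Δr g gbar x : ZMod n → ℝ)
    (hs : ∀ j, 0 < s j) (hr : ∀ j, 0 < r j) (hΔr : ∀ j, 0 ≤ Δr j)
    (hg : ∀ j, 0 < g j) (hggbar : ∀ j, g j ≤ gbar j)
    (hx : ∀ j, 0 < x j ∧ x j < 1)
    (rt X : ZMod n → ℝ)
    (hrt : ∀ j, rt j = r j + Δr j) (hX : ∀ j, X j = x j / (1 - x j))
    (m : ℕ) (hm : m = ∑ j, b j) (hm0 : 0 < m) (hmn : m < n)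
    (d : ℕ → ZMod n → ℝ)
    (hdyn : ∀ k : ℕ, 1 ≤ k → ∀ j : ZMod n,
      d k j = max (d (k - b j) (j - 1) + (rt j + X j * g j))
        (d (k - (1 - b (j + 1))) (j + 1) + s (j + 1)))
    (f : ℝ)
    (hf : f = min ((m : ℝ) / (∑ j, (g j * X j + rt j)))
      (min (1 / ⨆ j, (g j * X j + rt j + s j)) (((n : ℝ) - (m : ℝ)) / (∑ j, s j)))) :
    ∀ j : ZMod n, Tendsto (fun k : ℕ => (k : ℝ) / d k j) atTop (nhds f) := by
  subst hm
  have hX0 : ∀ j, 0 < X j := fun j => by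
    rw [hX]; exact div_pos (hx j).1 (sub_pos.2 (hx j).2)
  set t : ZMod n → ℝ := fun j => g j * X j + rt j with ht
  have ht0 : ∀ j, 0 < t j := fun j => by
    have h1 := mul_pos (hg j) (hX0 j)
    have h2 := hr j
    have h3 := hΔr j
    simp only [ht, hrt j]
    linarith
  have hdyn' : ∀ k : ℕ, 1 ≤ k → ∀ j, d k j = max (d (k - b j) (j - 1) + t j)
      (d (k - (1 - b (j + 1))) (j + 1) + s (j + 1)) := fun k hk j => by
    rw [hdyn k hk j, ht, add_comm (rt j), mul_comm (X j)]
  have hfwd : ∀ k : ℕ, 1 ≤ k → ∀ j, d (k - b j) (j - 1) + t j ≤ d k j := fun k hk j => by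
    rw [hdyn' k hk j]; exact le_max_left _ _
  have hbwd : ∀ k : ℕ, 1 ≤ k → ∀ j, d (k - (1 - b (j + 1))) (j + 1) + s (j + 1) ≤ d k j :=
    fun k hk j => by rw [hdyn' k hk j]; exact le_max_right _ _
  have hT : 0 < ∑ j, t j := Finset.sum_pos (fun j _ => ht0 j) Finset.univ_nonempty
  have hS : 0 < ∑ j, s j := Finset.sum_pos (fun j _ => hs j) Finset.univ_nonempty
  have hle : ∀ j, t j + s j ≤ ⨆ j, (t j + s j) :=
    le_ciSup (f := fun j => t j + s j) (Set.finite_range _).bddAbove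
  obtain ⟨j₀, hj₀⟩ := exists_eq_ciSup_of_finite (f := fun j => t j + s j)
  have hM : 0 < ⨆ j, (t j + s j) := by rw [← hj₀]; exact add_pos (ht0 _) (hs _)
  change f = min (_ / ∑ j, t j) (min (1 / ⨆ j, (t j + s j)) _) at hf
  have hm0' : (0 : ℝ) < (∑ j, b j : ℕ) := by exact_mod_cast hm0
  have hmn' : (0 : ℝ) < n - (∑ j, b j : ℕ) := sub_pos.2 (by exact_mod_cast hmn)
  have hfpos : 0 < f := by
    rw [hf]
    exact lt_min (div_pos hm0' hT) (lt_min (one_div_pos.2 hM) (div_pos hmn' hS))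
  have hf1 : f ≤ (∑ j, b j : ℕ) / ∑ j, t j := hf ▸ min_le_left _ _
  have hf2 : f ≤ 1 / ⨆ j, (t j + s j) := hf ▸ (min_le_right _ _).trans (min_le_left _ _)
  have hf3 : f ≤ (n - (∑ j, b j : ℕ)) / ∑ j, s j :=
    hf ▸ (min_le_right _ _).trans (min_le_right _ _)
  rw [le_div_iff₀ hT] at hf1
  rw [le_div_iff₀ hM] at hf2
  rw [le_div_iff₀ hS] at hf3
  obtain ⟨D, hD⟩ := line_departure_upper_bound n b hb hm0 hmn t s d f⁻¹ hdyn'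
    (by rw [← div_eq_mul_inv, le_div_iff₀ hfpos]; linarith)
    (fun j => (hle j).trans (by rw [← one_div, le_div_iff₀ hfpos]; linarith))
    (by rw [← div_eq_mul_inv, le_div_iff₀ hfpos]; linarith)
  intro j
  obtain ⟨C, hC⟩ : ∃ C, ∀ k : ℕ, f⁻¹ * k + C ≤ d k j := by
    rcases min_choice ((∑ j, b j : ℕ) / ∑ j, t j)
        (min (1 / ⨆ j, (t j + s j)) ((n - (∑ j, b j : ℕ)) / ∑ j, s j)) with h | h
    · rw [h] at hf
      obtain ⟨C, hC⟩ := line_departure_lower_bound_of_trains n b hb hm0 hmn t d f⁻¹ hfwd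
        (by rw [hf, inv_div, mul_div_cancel₀ _ hm0'.ne'])
      exact ⟨C, fun k => hC k j⟩
    · rw [h] at hf
      rcases min_choice (1 / ⨆ j, (t j + s j)) ((n - (∑ j, b j : ℕ)) / ∑ j, s j) with h | h
      · have hinv : f⁻¹ = t j₀ + s j₀ := by rw [hf, h, one_div, inv_inv, ← hj₀]
        rw [hinv]
        exact line_departure_lower_bound_of_segment n b hb t s d hfwd hbwd j₀ j
      · rw [h] at hf
        obtain ⟨C, hC⟩ := line_departure_lower_bound_of_gaps n b hb hm0 hmn s d f⁻¹ hbwd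
          (by rw [hf, inv_div, mul_div_cancel₀ _ hmn'.ne'])
        exact ⟨C, fun k => hC k j⟩
  simpa using tendsto_natCast_div_of_linear_bounds (fun k => d k j) f⁻¹ C D
    (inv_ne_zero hfpos.ne') hC fun k => hD k j
end

section
/- (i) For every real m ≥ 0 and every real Δm, f0(m,Δm) ≤ m/T̄; consequently, any pair (m,Δm) with f0(m,Δm) = f_max satisfies m ≥ T̄·f_max. (ii) If at the point (m*, Δm*) = (T̄·f_max, (ΔT/2)·f_max) each of the five remaining terms of the minimum defining f0 — namely 1/h_min, (n−m*−(Δn−Δm*))/(S0+S1), (n−m*+(Δn−Δm*))/(S0+S2), 2(n2−Δm*)/(T1+S2) and 2(n1+Δm*)/(S1+T2) — is ≥ f_max, then f0(m*, Δm*) = f_max; thus m* = T̄·f_max is the minimum number of trains realizing the maximum asymptotic average frequency f_max, attained with the difference Δm* = (ΔT/2)·f_max between the number of trains on the branches. -/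
/-- The smaller of two fractions with positive denominators is at most their mediant. -/
theorem min_div_div_le_mediant {a b c d : ℝ} (hc : 0 < c) (hd : 0 < d) :
    min (a / c) (b / d) ≤ (a + b) / (c + d) := by
  have hac : min (a / c) (b / d) * c ≤ a := (le_div_iff₀ hc).1 (min_le_left _ _)
  have hbd : min (a / c) (b / d) * d ≤ b := (le_div_iff₀ hd).1 (min_le_right _ _)
  rw [le_div_iff₀ (add_pos hc hd)]
  linarith


/-- (i) For every `m ≥ 0` and every `Δm`, `f0(m,Δm) ≤ m/T̄`; consequently, any pair
`(m,Δm)` with `f0(m,Δm) = f_max` satisfies `m ≥ T̄·f_max`.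
(ii) If at the point `(m*, Δm*) = (T̄·f_max, (ΔT/2)·f_max)` each of the five remaining
terms of the minimum defining `f0` is at least `f_max`, then `f0(m*, Δm*) = f_max`;
thus `m* = T̄·f_max` is the minimum number of trains realizing the maximum asymptotic
average frequency `f_max`, attained with the difference `Δm* = (ΔT/2)·f_max`. -/
theorem junction_minimum_trains_for_max_frequency
    (n0 n1 n2 : ℕ)
    (T0 T1 T2 S0 S1 S2 hmin : ℝ)
    (hT0 : 0 < T0) (hT1 : 0 < T1) (hT2 : 0 < T2)
    (hS0 : 0 < S0) (hS1 : 0 < S1) (hS2 : 0 < S2)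
    (hhmin : 0 < hmin)
    (n : ℕ) (hn : n = n0 + n1 + n2)
    (Δn : ℤ) (hΔn : Δn = (n2 : ℤ) - (n1 : ℤ))
    (f0 : ℝ → ℝ → ℝ)
    (hf0 : ∀ m Δm : ℝ, f0 m Δm = max 0
      (min (min (min ((m - Δm) / (T0 + T1)) ((m + Δm) / (T0 + T2)))
          (min (1 / hmin) (((n : ℝ) - m - ((Δn : ℝ) - Δm)) / (S0 + S1))))
        (min (min (((n : ℝ) - m + ((Δn : ℝ) - Δm)) / (S0 + S2))
            (2 * ((n2 : ℝ) - Δm) / (T1 + S2)))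
          (2 * ((n1 : ℝ) + Δm) / (S1 + T2)))))
    (Tbar ΔT fmax : ℝ)
    (hTbar : Tbar = (2 * T0 + T1 + T2) / 2) (hΔT : ΔT = T2 - T1)
    (hfmax : fmax = 1 / hmin) :
    (∀ m Δm : ℝ, 0 ≤ m → f0 m Δm ≤ m / Tbar) ∧
    (∀ m Δm : ℝ, f0 m Δm = fmax → Tbar * fmax ≤ m) ∧
    ((fmax ≤ 1 / hmin ∧
      fmax ≤ ((n : ℝ) - Tbar * fmax - ((Δn : ℝ) - (ΔT / 2) * fmax)) / (S0 + S1) ∧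
      fmax ≤ ((n : ℝ) - Tbar * fmax + ((Δn : ℝ) - (ΔT / 2) * fmax)) / (S0 + S2) ∧
      fmax ≤ 2 * ((n2 : ℝ) - (ΔT / 2) * fmax) / (T1 + S2) ∧
      fmax ≤ 2 * ((n1 : ℝ) + (ΔT / 2) * fmax) / (S1 + T2)) →
      f0 (Tbar * fmax) ((ΔT / 2) * fmax) = fmax) := by
  have hA : 0 < T0 + T1 := add_pos hT0 hT1
  have hB : 0 < T0 + T2 := add_pos hT0 hT2
  have hTbar_pos : 0 < Tbar := by rw [hTbar]; positivity
  have hfmax_pos : 0 < fmax := by rw [hfmax]; positivity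
  have f0_le (m Δm : ℝ) : f0 m Δm ≤ max 0 (m / Tbar) := by
    rw [hf0]
    refine max_le_max le_rfl ?_
    calc
      _ ≤ min ((m - Δm) / (T0 + T1)) ((m + Δm) / (T0 + T2)) :=
        (min_le_left _ _).trans (min_le_left _ _)
      _ ≤ ((m - Δm) + (m + Δm)) / ((T0 + T1) + (T0 + T2)) := min_div_div_le_mediant hA hB
      _ = (2 * m) / (2 * Tbar) := by rw [hTbar]; congr 1 <;> ring
      _ = m / Tbar := mul_div_mul_left _ _ two_ne_zero
  refine ⟨fun m Δm hm => ?_, fun m Δm h => ?_, ?_⟩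
  · simpa [max_eq_right (div_nonneg hm hTbar_pos.le)] using f0_le m Δm
  · have hle : fmax ≤ m / Tbar :=
      (le_max_iff.1 (h ▸ f0_le m Δm)).resolve_left hfmax_pos.not_ge
    rw [le_div_iff₀ hTbar_pos] at hle
    linarith
  · rintro ⟨h₃, h₄, h₅, h₆, h₇⟩
    have h₁ : (Tbar * fmax - ΔT / 2 * fmax) / (T0 + T1) = fmax := by
      rw [div_eq_iff hA.ne', hTbar, hΔT]
      ring
    have h₂ : (Tbar * fmax + ΔT / 2 * fmax) / (T0 + T2) = fmax := by
      rw [div_eq_iff hB.ne', hTbar, hΔT]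
      ring
    rw [hf0, h₁, h₂, min_self]
    apply le_antisymm
    · exact max_le hfmax_pos.le ((min_le_left _ _).trans (min_le_left _ _))
    · exact le_max_of_le_right
        (le_min (le_min le_rfl (le_min h₃ h₄)) (le_min (le_min h₅ h₆) h₇))
end

section
/- Assume A·f_max + B·f_max ≤ n. Then, viewing the number of trains m as a real variable in (0,n): h(m,X) = h_min if and only if A·f_max ≤ m ≤ n − B·f_max (maximum frequency phase); for 0 < m ≤ A·f_max one has h(m,X) = A/m, which is strictly decreasing in m (free flow phase); and for n − B·f_max ≤ m < n one has h(m,X) = B/(n−m), which is strictly increasing in m (congestion phase). In particular, the minimum number of trains realizing the maximum asymptotic average frequency f_max is m = A·f_max. -/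
theorem div_le_iff_mul_one_div_le {a b c : ℝ} (hb : 0 < b) (hc : 0 < c) :
    a / b ≤ c ↔ a * (1 / c) ≤ b := by
  rw [div_le_iff₀ hb, mul_one_div, div_le_iff₀ hc, mul_comm]

theorem le_div_iff_le_mul_one_div {a b c : ℝ} (hb : 0 < b) (hc : 0 < c) :
    c ≤ a / b ↔ b ≤ a * (1 / c) := by
  rw [le_div_iff₀ hb, mul_one_div, le_div_iff₀ hc, mul_comm]

/-- Traffic phases of a linear metro line with demand-dependent controlled travel
times. Assume `A·f_max + B·f_max ≤ n`. Then, for real `m ∈ (0,n)`: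
`h(m,X) = h_min` iff `A·f_max ≤ m ≤ n − B·f_max` (maximum frequency phase);
for `0 < m ≤ A·f_max`, `h(m,X) = A/m`, strictly decreasing in `m` (free flow phase);
for `n − B·f_max ≤ m < n`, `h(m,X) = B/(n−m)`, strictly increasing in `m` (congestion
phase). In particular the minimum number of trains realizing the maximum frequency
`f_max` is `m = A·f_max`. -/
theorem linear_line_traffic_phases
    (n : ℕ) (hn : 0 < n)
    (g rt s X : Fin n → ℝ)
    (hg : ∀ j, 0 < g j) (hrt : ∀ j, 0 < rt j) (hs : ∀ j, 0 < s j) (hX : ∀ j, 0 ≤ X j)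
    (A B hmin fmax : ℝ)
    (hA : A = ∑ j, (g j * X j + rt j)) (hB : B = ∑ j, s j)
    (hhmin : hmin = ⨆ j, (g j * X j + rt j + s j)) (hfmax : fmax = 1 / hmin)
    (h : ℝ → ℝ)
    (hh : ∀ m : ℝ, h m = max (A / m) (max hmin (B / ((n : ℝ) - m))))
    (hcap : A * fmax + B * fmax ≤ (n : ℝ)) :
    (∀ m : ℝ, 0 < m → m < (n : ℝ) →
      (h m = hmin ↔ (A * fmax ≤ m ∧ m ≤ (n : ℝ) - B * fmax))) ∧
    (∀ m : ℝ, 0 < m → m ≤ A * fmax → h m = A / m) ∧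
    (∀ m₁ m₂ : ℝ, 0 < m₁ → m₁ < m₂ → m₂ ≤ A * fmax → h m₂ < h m₁) ∧
    (∀ m : ℝ, (n : ℝ) - B * fmax ≤ m → m < (n : ℝ) → h m = B / ((n : ℝ) - m)) ∧
    (∀ m₁ m₂ : ℝ, (n : ℝ) - B * fmax ≤ m₁ → m₁ < m₂ → m₂ < (n : ℝ) → h m₁ < h m₂) ∧
    (h (A * fmax) = hmin ∧
      ∀ m : ℝ, 0 < m → m < (n : ℝ) → h m = hmin → A * fmax ≤ m) := by
  have hterm : ∀ j, 0 < g j * X j + rt j := fun j =>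
    add_pos_of_nonneg_of_pos (mul_nonneg (hg j).le (hX j)) (hrt j)
  have hne : (Finset.univ : Finset (Fin n)).Nonempty := ⟨⟨0, hn⟩, Finset.mem_univ _⟩
  have hApos : 0 < A := hA ▸ Finset.sum_pos (fun j _ => hterm j) hne
  have hBpos : 0 < B := hB ▸ Finset.sum_pos (fun j _ => hs j) hne
  have hpos : 0 < hmin := by
    rw [hhmin]
    exact (add_pos (hterm ⟨0, hn⟩) (hs _)).trans_le
      (le_ciSup (f := fun j => g j * X j + rt j + s j) (Set.finite_range _).bddAbove ⟨0, hn⟩)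
  have hAf : 0 < A * fmax := by rw [hfmax]; positivity
  have hBf : 0 < B * fmax := by rw [hfmax]; positivity
  have div_le_hmin : ∀ {a b : ℝ}, 0 < b → (a / b ≤ hmin ↔ a * fmax ≤ b) := fun hb =>
    hfmax ▸ div_le_iff_mul_one_div_le hb hpos
  have hmin_le_div : ∀ {a b : ℝ}, 0 < b → (hmin ≤ a / b ↔ b ≤ a * fmax) := fun hb =>
    hfmax ▸ le_div_iff_le_mul_one_div hb hpos
  have max_phase : ∀ m : ℝ, 0 < m → m < (n : ℝ) →
      (h m = hmin ↔ (A * fmax ≤ m ∧ m ≤ (n : ℝ) - B * fmax)) := by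
    intro m hm hmn
    have hnm : 0 < (n : ℝ) - m := sub_pos.2 hmn
    rw [le_sub_comm, ← div_le_hmin hm, ← div_le_hmin hnm, hh]
    constructor
    · intro e
      exact ⟨(le_max_left _ _).trans e.le, ((le_max_right _ _).trans (le_max_right _ _)).trans e.le⟩
    · rintro ⟨h₁, h₂⟩
      rw [max_eq_left h₂, max_eq_right h₁]
  have free_flow : ∀ m : ℝ, 0 < m → m ≤ A * fmax → h m = A / m := by
    intro m hm hle
    have h₁ := (hmin_le_div hm).2 hle
    have h₂ : B / ((n : ℝ) - m) ≤ hmin := (div_le_hmin (by linarith)).2 (by linarith)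
    rw [hh, max_eq_left h₂, max_eq_left h₁]
  have congestion : ∀ m : ℝ, (n : ℝ) - B * fmax ≤ m → m < (n : ℝ) →
      h m = B / ((n : ℝ) - m) := by
    intro m hle hmn
    have h₁ : hmin ≤ B / ((n : ℝ) - m) := (hmin_le_div (sub_pos.2 hmn)).2 (by linarith)
    have h₂ : A / m ≤ hmin := (div_le_hmin (by linarith)).2 (by linarith)
    rw [hh, max_eq_right h₁, max_eq_right (h₂.trans h₁)]
  refine ⟨max_phase, free_flow, ?_, congestion, ?_, ?_, ?_⟩
  · intro m₁ m₂ h₁ h₁₂ h₂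
    rw [free_flow m₁ h₁ (h₁₂.le.trans h₂), free_flow m₂ (h₁.trans h₁₂) h₂]
    exact div_lt_div_of_pos_left hApos h₁ h₁₂
  · intro m₁ m₂ h₁ h₁₂ h₂
    rw [congestion m₁ h₁ (h₁₂.trans h₂), congestion m₂ (h₁.trans h₁₂.le) h₂]
    exact div_lt_div_of_pos_left hBpos (sub_pos.2 h₂) (sub_lt_sub_left h₁₂ _)
  · exact (max_phase _ hAf (by linarith)).2 ⟨le_rfl, by linarith⟩
  · exact fun m hm hmn e => ((max_phase m hm hmn).1 e).1
end

section
/- Consider the controlled train dynamics d^k_j = max( (1−δ_j)·d^{k−b_j}_{j−1} + δ_j·d^{k−1}_j + (1−δ_j)·(r̃_j + X_j·g_j), d^{k−b̄_{j+1}}_{j+1} + s_{j+1} ) for all k ≥ 1 and all j, where δ_j = γ_j·x_j/(1+γ_j·x_j) ∈ [0,1). If 0 < m < n, then these dynamics admit a stationary regime with a unique asymptotic average growth rate: there exists h ∈ ℝ such that for every choice of initial departure times and for every j, d^k_j/k converges to h as k → ∞; h is interpreted as the asymptotic average train time-headway. -/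
open Filter

/-- Departure times `d` obey the controlled train dynamics with occupancy `b`, control weights `δ`,
travel constants `c` and separation times `s`. -/
def IsTrainSchedule {n : ℕ} (b : ZMod n → ℕ) (δ c s : ZMod n → ℝ) (d : ℕ → ZMod n → ℝ) : Prop :=
  ∀ k : ℕ, 1 ≤ k → ∀ j : ZMod n,
    d k j = max ((1 - δ j) * d (k - b j) (j - 1) + δ j * d (k - 1) j + c j)
      (d (k - (1 - b (j + 1))) (j + 1) + s (j + 1))

theorem ZMod.forall_of_forall_add_one {n : ℕ} [NeZero n] {P : ZMod n → Prop}
    (step : ∀ j, P j → P (j + 1)) {j : ZMod n} (hj : P j) (i : ZMod n) : P i := by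
  have key : ∀ t : ℕ, P (j + t) := fun t => by
    induction t with
    | zero => simpa using hj
    | succ t ih => simpa [add_assoc] using step _ ih
  simpa using key (i - j).val

theorem ZMod.forall_of_forall_sub_one {n : ℕ} [NeZero n] {P : ZMod n → Prop}
    (step : ∀ j, P j → P (j - 1)) {j : ZMod n} (hj : P j) (i : ZMod n) : P i := by
  have := ZMod.forall_of_forall_add_one (P := fun i => P (-i)) (j := -j)
    (fun i hi => by simpa [sub_eq_add_neg, add_comm] using step _ hi) (by simpa using hj) (-i)
  simpa using this

theorem exists_forall_apply_le {ι : Type*} [Finite ι] (f : ι → ℝ) : ∃ C, ∀ i, f i ≤ C := by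
  obtain ⟨C, hC⟩ := Set.finite_range f |>.bddAbove
  exact ⟨C, fun i => hC ⟨i, rfl⟩⟩

/-- If every site in `P` has an instantaneous predecessor in `P`, and the line is neither empty
nor full, then `P` is empty. -/
theorem not_of_instantaneous_predecessor {n : ℕ} [NeZero n] {b : ZMod n → ℕ}
    (hempty : ∃ j, b j ≠ 0) (hfull : ∃ j, b j ≠ 1) {P : ZMod n → Prop}
    (hP : ∀ j, P j → (b j = 0 ∧ P (j - 1)) ∨ (b (j + 1) = 1 ∧ P (j + 1))) (j : ZMod n) :
    ¬ P j := by
  have hne_one : ∀ i, P i → b i ≠ 1 := fun i hi hbi => by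
    obtain ⟨l, hl⟩ := hfull
    refine hl (ZMod.forall_of_forall_add_one (P := fun i => P i ∧ b i = 1) ?_ ⟨hi, hbi⟩ l).2
    rintro q ⟨hq, hbq⟩
    rcases hP q hq with ⟨h0, -⟩ | ⟨h1, h2⟩
    · omega
    · exact ⟨h2, h1⟩
  have hback : ∀ i, P i → b i = 0 ∧ P (i - 1) := fun i hi =>
    (hP i hi).resolve_right fun h => hne_one _ h.2 h.1
  intro hj
  obtain ⟨l, hl⟩ := hempty
  exact hl (hback l (ZMod.forall_of_forall_sub_one (fun i hi => (hback i hi).2) hj l)).1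

theorem tendsto_div_natCast_of_abs_sub_le {u v : ℕ → ℝ} {h E : ℝ}
    (hu : Tendsto (fun k : ℕ => u k / k) atTop (nhds h)) (huv : ∀ k, |v k - u k| ≤ E) :
    Tendsto (fun k : ℕ => v k / k) atTop (nhds h) := by
  have hdiff : Tendsto (fun k : ℕ => (v k - u k) / k) atTop (nhds 0) := by
    refine squeeze_zero_norm (fun k => ?_) (tendsto_const_div_atTop_nhds_zero_nat E)
    rw [norm_div, Real.norm_eq_abs, RCLike.norm_natCast]
    exact div_le_div_of_nonneg_right (huv k) (Nat.cast_nonneg k)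
  have := hu.add hdiff
  simp only [← add_div, add_sub_cancel, add_zero] at this
  exact this

namespace IsTrainSchedule

variable {n : ℕ} {b : ZMod n → ℕ} {δ c s : ZMod n → ℝ} {d d' : ℕ → ZMod n → ℝ}

theorem shift (hb : ∀ j, b j ≤ 1) (hd : IsTrainSchedule b δ c s d) (p : ℕ) :
    IsTrainSchedule b δ c s (fun k => d (k + p)) := by
  intro k hk j
  have h1 : k + p - b j = k - b j + p := by have := hb j; omega
  have h2 : k + p - 1 = k - 1 + p := by omega
  have h3 : k + p - (1 - b (j + 1)) = k - (1 - b (j + 1)) + p := by omega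
  have := hd (k + p) (by omega) j
  rwa [h1, h2, h3] at this

theorem le_add_const [NeZero n] (hb : ∀ j, b j ≤ 1) (hempty : ∃ j, b j ≠ 0)
    (hfull : ∃ j, b j ≠ 1) (hδ : ∀ j, 0 ≤ δ j ∧ δ j < 1)
    (hd : IsTrainSchedule b δ c s d) (hd' : IsTrainSchedule b δ c s d') {a : ℝ}
    (h0 : ∀ j, d 0 j ≤ d' 0 j + a) (k : ℕ) (j : ZMod n) : d k j ≤ d' k j + a := by
  induction k generalizing j with
  | zero => exact h0 j
  | succ k ih =>
    rw [← not_lt]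
    refine not_of_instantaneous_predecessor (P := fun j => d' (k + 1) j + a < d (k + 1) j)
      hempty hfull (fun i hi => ?_) j
    have e := hd (k + 1) (by omega) i
    have e' := hd' (k + 1) (by omega) i
    simp only [Nat.add_sub_cancel] at e e'
    by_contra hcon
    rw [not_or, not_and, not_and, not_lt, not_lt] at hcon
    have hback : d (k + 1 - b i) (i - 1) ≤ d' (k + 1 - b i) (i - 1) + a := by
      rcases Nat.le_one_iff_eq_zero_or_eq_one.mp (hb i) with h | h
      · simpa [h] using hcon.1 h
      · simpa [h] using ih (i - 1)
    have hfwd : d (k + 1 - (1 - b (i + 1))) (i + 1)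
        ≤ d' (k + 1 - (1 - b (i + 1))) (i + 1) + a := by
      rcases Nat.le_one_iff_eq_zero_or_eq_one.mp (hb (i + 1)) with h | h
      · simpa [h] using ih (i + 1)
      · simpa [h] using hcon.2 h
    refine hi.not_ge ?_
    rw [e, e']
    refine max_le ?_ ?_
    · have h1 := mul_le_mul_of_nonneg_left hback (sub_nonneg.mpr (hδ i).2.le)
      have h2 := mul_le_mul_of_nonneg_left (ih i) (hδ i).1
      refine le_trans ?_ (add_le_add_left (le_max_left _ _) a)
      linarith
    · refine le_trans ?_ (add_le_add_left (le_max_right _ _) a)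
      linarith

theorem exists_abs_sub_le [NeZero n] (hb : ∀ j, b j ≤ 1) (hempty : ∃ j, b j ≠ 0)
    (hfull : ∃ j, b j ≠ 1) (hδ : ∀ j, 0 ≤ δ j ∧ δ j < 1)
    (hd : IsTrainSchedule b δ c s d) (hd' : IsTrainSchedule b δ c s d') :
    ∃ E, ∀ k j, |d k j - d' k j| ≤ E := by
  obtain ⟨E, hE⟩ := exists_forall_apply_le fun j => |d 0 j - d' 0 j|
  refine ⟨E, fun k j => abs_le.mpr ?_⟩
  have h1 := le_add_const hb hempty hfull hδ hd hd' (a := E)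
    (fun i => by linarith [(abs_le.mp (hE i)).2]) k j
  have h2 := le_add_const hb hempty hfull hδ hd' hd (a := E)
    (fun i => by linarith [(abs_le.mp (hE i)).1]) k j
  constructor <;> linarith

theorem exists_tendsto_div [NeZero n] (hb : ∀ j, b j ≤ 1) (hempty : ∃ j, b j ≠ 0)
    (hfull : ∃ j, b j ≠ 1) (hδ : ∀ j, 0 ≤ δ j ∧ δ j < 1) (hs : ∀ j, 0 < s j)
    (hd : IsTrainSchedule b δ c s d) :
    ∃ h, ∀ j, Tendsto (fun k : ℕ => d k j / k) atTop (nhds h) := by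
  obtain ⟨C, hC⟩ := exists_abs_sub_le hb hempty hfull hδ (hd.shift hb 1) hd
  have hC0 : 0 ≤ C := (abs_nonneg _).trans (hC 0 0)
  obtain ⟨A, hA⟩ := exists_forall_apply_le fun j => |d 0 j|
  have hneighbour : ∀ k j, d k (j + 1) ≤ d k j + (C + 2 * A) := fun k j => by
    have hA1 := abs_le.mp (hA j)
    have hA2 := abs_le.mp (hA (j + 1))
    rcases k with _ | k
    · linarith
    · have h1 := hd (k + 1) (by omega) j
      have h2 := (le_max_right _ _).trans_eq h1.symm
      have h3 := hs (j + 1)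
      have h4 := abs_le.mp (hC k (j + 1))
      rcases Nat.le_one_iff_eq_zero_or_eq_one.mp (hb (j + 1)) with h | h <;>
        simp [h] at h2 <;> linarith
  have hB0 : 0 ≤ C + 2 * A := by linarith [(abs_nonneg _).trans (hA 0)]
  obtain ⟨B, hB⟩ : ∃ B, ∀ k i j, d k i ≤ d k j + B := by
    refine ⟨n * (C + 2 * A), fun k i j => ?_⟩
    have key : ∀ t : ℕ, d k (j + t) ≤ d k j + t * (C + 2 * A) := fun t => by
      induction t with
      | zero => simp
      | succ t ih =>
        have := hneighbour k (j + t)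
        push_cast
        rw [← add_assoc]
        linarith
    have h1 := key (i - j).val
    have h2 : (((i - j).val : ℕ) : ℝ) ≤ n := by exact_mod_cast (ZMod.val_lt _).le
    have h3 := mul_le_mul_of_nonneg_right h2 hB0
    rw [ZMod.natCast_zmod_val, add_sub_cancel] at h1
    linarith
  have hlower : ∀ k : ℕ, d 0 0 - k * C ≤ d k 0 := fun k => by
    induction k with
    | zero => simp
    | succ k ih =>
      have := (abs_le.mp (hC k 0)).1
      push_cast
      linarith
  set u : ℕ → ℝ := fun k => d k 0 - d 0 0 + 2 * B with hu
  have hsub : Subadditive u := fun k p => by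
    have := le_add_const hb hempty hfull hδ (hd.shift hb p) hd (a := d p 0 - d 0 0 + 2 * B)
      (fun j => by
        have h1 := hB p j 0
        have h2 := hB 0 0 j
        rw [zero_add]
        linarith) k 0
    simp only [hu]
    linarith
  have hbdd : BddBelow (Set.range fun k : ℕ => u k / k) := by
    refine ⟨-C, ?_⟩
    rintro _ ⟨k, rfl⟩
    rcases k.eq_zero_or_pos with rfl | hk
    · simpa using hC0
    · rw [le_div_iff₀ (Nat.cast_pos.mpr hk)]
      simp only [hu]
      linarith [hlower k, hB 0 0 0]
  refine ⟨hsub.lim, fun j =>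
    tendsto_div_natCast_of_abs_sub_le (hsub.tendsto_lim hbdd) (E := 3 * B + |d 0 0|) fun k => ?_⟩
  have h1 := hB k j 0
  have h2 := hB k 0 j
  have h3 := hB 0 0 0
  have h4 := neg_abs_le (d 0 0)
  have h5 := le_abs_self (d 0 0)
  simp only [hu]
  exact abs_le.mpr ⟨by linarith, by linarith⟩

theorem exists_forall_tendsto_div [NeZero n] (hb : ∀ j, b j ≤ 1) (hempty : ∃ j, b j ≠ 0)
    (hfull : ∃ j, b j ≠ 1) (hδ : ∀ j, 0 ≤ δ j ∧ δ j < 1) (hs : ∀ j, 0 < s j) :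
    ∃ h, ∀ d, IsTrainSchedule b δ c s d →
      ∀ j, Tendsto (fun k : ℕ => d k j / k) atTop (nhds h) := by
  by_cases hex : ∃ d₀, IsTrainSchedule b δ c s d₀
  · obtain ⟨d₀, hd₀⟩ := hex
    obtain ⟨h, hh⟩ := exists_tendsto_div hb hempty hfull hδ hs hd₀
    refine ⟨h, fun d hd j => ?_⟩
    obtain ⟨E, hE⟩ := exists_abs_sub_le hb hempty hfull hδ hd hd₀
    exact tendsto_div_natCast_of_abs_sub_le (hh j) fun k => hE k j
  · exact ⟨0, fun d hd => absurd ⟨d, hd⟩ hex⟩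

end IsTrainSchedule

/-- The controlled train dynamics
`d^k_j = max((1−δ_j)·d^{k−b_j}_{j−1} + δ_j·d^{k−1}_j + (1−δ_j)·(r̃_j + X_j·g_j),
d^{k−b̄_{j+1}}_{j+1} + s_{j+1})` with `δ_j = γ_j·x_j/(1+γ_j·x_j) ∈ [0,1)` admit, when
`0 < m < n`, a stationary regime with a unique asymptotic average growth rate: there
exists `h ∈ ℝ` such that for every choice of initial departure times and every `j`,
`d^k_j/k → h`; `h` is the asymptotic average train time-headway. -/
theorem linear_line_harmonizing_control_stationary_regime
    (n : ℕ) [NeZero n]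
    (b : ZMod n → ℕ) (hb : ∀ j, b j ≤ 1)
    (s r Δr g gbar x γ : ZMod n → ℝ)
    (hs : ∀ j, 0 < s j) (hr : ∀ j, 0 < r j) (hΔr : ∀ j, 0 ≤ Δr j)
    (hg : ∀ j, 0 < g j) (hggbar : ∀ j, g j ≤ gbar j)
    (hx : ∀ j, 0 < x j ∧ x j < 1)
    (hγ : ∀ j, 0 ≤ γ j ∧ γ j ≤ 1)
    (rt X δc : ZMod n → ℝ)
    (hrt : ∀ j, rt j = r j + Δr j) (hX : ∀ j, X j = x j / (1 - x j))
    (hδc : ∀ j, δc j = γ j * x j / (1 + γ j * x j))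
    (hδrange : ∀ j, 0 ≤ δc j ∧ δc j < 1)
    (m : ℕ) (hm : m = ∑ j, b j) (hm0 : 0 < m) (hmn : m < n) :
    ∃ h : ℝ, ∀ d : ℕ → ZMod n → ℝ,
      (∀ k : ℕ, 1 ≤ k → ∀ j : ZMod n,
        d k j = max ((1 - δc j) * d (k - b j) (j - 1) + δc j * d (k - 1) j
            + (1 - δc j) * (rt j + X j * g j))
          (d (k - (1 - b (j + 1))) (j + 1) + s (j + 1))) →
      ∀ j : ZMod n, Tendsto (fun k : ℕ => d k j / (k : ℝ)) atTop (nhds h) := by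
  have hempty : ∃ j, b j ≠ 0 := by
    by_contra! hcon
    simp [hcon] at hm
    omega
  have hfull : ∃ j, b j ≠ 1 := by
    by_contra! hcon
    simp [hcon] at hm
    omega
  exact IsTrainSchedule.exists_forall_tendsto_div (c := fun j => (1 - δc j) * (rt j + X j * g j))
    hb hempty hfull hδrange hs
end
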